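/- arXiv:2005.14068 — 3 statements merged into one kernel-verified Lean document; each statement's English description precedes it below -/
import Mathlib

section
/- Let r be a table over attributes A and B whose graph BG' is nonempty, connected, acyclic, and contains no 3-fan-out, so that BG' is a path v_1 — v_2 — ... — v_k alternating between A-values and B-values. Then every witness order of the implicit-to-implicit candidate A* ~ B* derives, on the A-values appearing on the path, either their order of appearance along the path v_1, ..., v_k or the reverse of that order, and simultaneously derives the correspondingly oriented order on the B-values appearing on the path; hence the derived orders restricted to the path's vertices are unique up to simultaneous reversal (polarity). -/
/-- The co-occurrence bipartite graph `BG` of the table. -/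
def coGraph {T α β : Type*} (fA : T → α) (fB : T → β) : SimpleGraph (α ⊕ β) :=
  SimpleGraph.fromRel (fun v u => ∃ t : T, v = Sum.inl (fA t) ∧ u = Sum.inr (fB t))

/-- A singleton: a vertex of degree 1 in `BG`. -/
def IsSingletonVtx {T α β : Type*} (fA : T → α) (fB : T → β) (v : α ⊕ β) : Prop :=
  ∃! u : α ⊕ β, (coGraph fA fB).Adj v u

/-- `BG'`: the graph obtained from `BG` by deleting all singletons together
with their incident edges. -/
def coGraph' {T α β : Type*} (fA : T → α) (fB : T → β) : SimpleGraph (α ⊕ β) :=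
  SimpleGraph.fromRel (fun v u =>
    (coGraph fA fB).Adj v u ∧ ¬ IsSingletonVtx fA fB v ∧ ¬ IsSingletonVtx fA fB u)

/-- A witness order for the implicit-to-implicit candidate `A* ~ B*`. -/
structure IsIIWitness {T α β : Type*} (fA : T → α) (fB : T → β)
    (w : T → T → Prop) : Prop where
  total : ∀ s t : T, s ≠ t → w s t ∨ w t s
  irrefl : ∀ s : T, ¬ w s s
  trans : ∀ s t u : T, w s t → w t u → w s u
  intervalA : ∀ s t u : T, w s t → w t u → fA s = fA u → fA s = fA t
  intervalB : ∀ s t u : T, w s t → w t u → fB s = fB u → fB s = fB t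

/-- The strict total order on A-values derived from a witness order. -/
def derivedA {T α : Type*} (fA : T → α) (w : T → T → Prop) (x y : α) : Prop :=
  x ≠ y ∧ ∃ s t : T, fA s = x ∧ fA t = y ∧ w s t

/-- The strict total order on B-values derived from a witness order. -/
def derivedB {T β : Type*} (fB : T → β) (w : T → T → Prop) (x y : β) : Prop :=
  x ≠ y ∧ ∃ s t : T, fB s = x ∧ fB t = y ∧ w s t

/-- Tuple `t` carries the value `x`. -/
def HasVal {T α β : Type*} (fA : T → α) (fB : T → β) (t : T) (x : α ⊕ β) : Prop :=
  x = Sum.inl (fA t) ∨ x = Sum.inr (fB t)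

theorem hasVal_of_adj {T α β : Type*} {fA : T → α} {fB : T → β} {x y : α ⊕ β}
    (h : (coGraph' fA fB).Adj x y) : ∃ t, HasVal fA fB t x ∧ HasVal fA fB t y := by
  have h2 : (coGraph fA fB).Adj x y := by
    simp only [coGraph', SimpleGraph.fromRel_adj] at h
    rcases h.2 with h | h
    · exact h.1
    · exact h.1.symm
  simp only [coGraph, SimpleGraph.fromRel_adj] at h2
  rcases h2.2 with ⟨t, h1, h2⟩ | ⟨t, h1, h2⟩
  · exact ⟨t, Or.inl h1, Or.inr h2⟩
  · exact ⟨t, Or.inr h2, Or.inl h1⟩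

theorem hasVal_pigeon {T α β : Type*} {fA : T → α} {fB : T → β} {t : T} {x y z : α ⊕ β}
    (hx : HasVal fA fB t x) (hy : HasVal fA fB t y) (hz : HasVal fA fB t z) :
    x = y ∨ z = x ∨ z = y := by
  unfold HasVal at *
  rcases hx with hx | hx <;> rcases hy with hy | hy <;> rcases hz with hz | hz <;>
    subst hx hy hz <;> simp

theorem hasVal_interval {T α β : Type*} {fA : T → α} {fB : T → β} {w : T → T → Prop}
    (hw : IsIIWitness fA fB w) {s t u : T} {x : α ⊕ β} (h1 : w s t) (h2 : w t u)
    (hs : HasVal fA fB s x) (hu : HasVal fA fB u x) : HasVal fA fB t x := by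
  unfold HasVal at *
  rcases hs with rfl | rfl
  · have h : fA s = fA u := by simpa using hu
    left; rw [hw.intervalA s t u h1 h2 h]
  · have h : fB s = fB u := by simpa using hu
    right; rw [hw.intervalB s t u h1 h2 h]

theorem witness_swap {T α β : Type*} {fA : T → α} {fB : T → β} {w : T → T → Prop}
    (hw : IsIIWitness fA fB w) : IsIIWitness fA fB (fun s t => w t s) where
  total s t h := (hw.total s t h).symm
  irrefl := hw.irrefl
  trans s t u h1 h2 := hw.trans _ _ _ h2 h1
  intervalA s t u h1 h2 h := by
    rw [h]; exact hw.intervalA u t s h2 h1 h.symm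
  intervalB s t u h1 h2 h := by
    rw [h]; exact hw.intervalB u t s h2 h1 h.symm

/-- One step: orientation propagates along the path. -/
theorem orient_step {T α β : Type*} {fA : T → α} {fB : T → β} {w : T → T → Prop}
    (hw : IsIIWitness fA fB w) {a b c d : α ⊕ β} {s t u : T}
    (hac : a ≠ c) (hbc : b ≠ c) (hbd : b ≠ d) (hcd : c ≠ d) (hab : a ≠ b)
    (hsa : HasVal fA fB s a) (hsb : HasVal fA fB s b)
    (htb : HasVal fA fB t b) (htc : HasVal fA fB t c)
    (huc : HasVal fA fB u c) (hud : HasVal fA fB u d) (h : w s t) : w t u := by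
  have hsc : ¬ HasVal fA fB s c := fun h => by
    rcases hasVal_pigeon hsa hsb h with h | h | h <;> grind
  have hub : ¬ HasVal fA fB u b := fun h => by
    rcases hasVal_pigeon huc hud h with h | h | h <;> grind
  have htu : t ≠ u := by rintro rfl; exact hub htb
  have hsu : s ≠ u := by rintro rfl; exact hsc huc
  rcases hw.total t u htu with h1 | h1
  · exact h1
  rcases hw.total s u hsu with h2 | h2
  · exact absurd (hasVal_interval hw h2 h1 hsb htb) hub
  · exact absurd (hasVal_interval hw h2 h huc htc) hsc

/-- The blocks of two distinct values cannot precede each other both ways. -/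
theorem derived_asymm {T α β : Type*} {fA : T → α} {fB : T → β} {w : T → T → Prop}
    (hw : IsIIWitness fA fB w) {x y : α ⊕ β} {s t s' t' : T}
    (hsy : ¬ HasVal fA fB s y) (htx : ¬ HasVal fA fB t x)
    (hsy' : ¬ HasVal fA fB s' y) (htx' : ¬ HasVal fA fB t' x)
    (hs : HasVal fA fB s x) (ht : HasVal fA fB t y)
    (hs' : HasVal fA fB s' x) (ht' : HasVal fA fB t' y)
    (h : w s t) (h' : w t' s') : False := by
  have h1 : w s t' := by
    have hne : s ≠ t' := by rintro rfl; exact htx' hs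
    rcases hw.total s t' hne with h1 | h1
    · exact h1
    · exact absurd (hasVal_interval hw h1 h ht' ht) hsy
  exact htx' (hasVal_interval hw h1 h' hs hs')

theorem oriented {T α β : Type*} {fA : T → α} {fB : T → β}
    {k : ℕ} {v : Fin k → α ⊕ β} {τ : ℕ → T}
    (hτ : ∀ n (h : n + 1 < k), HasVal fA fB (τ n) (v ⟨n, by omega⟩) ∧
      HasVal fA fB (τ n) (v ⟨n + 1, h⟩))
    (hinj : Function.Injective v) (w : T → T → Prop) (hw : IsIIWitness fA fB w)
    (h0 : 2 < k → w (τ 0) (τ 1)) :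
    ((∀ i j : Fin k, ∀ x y : α, v i = Sum.inl x → v j = Sum.inl y →
          (derivedA fA w x y ↔ i < j)) ∧
       (∀ i j : Fin k, ∀ x y : β, v i = Sum.inr x → v j = Sum.inr y →
          (derivedB fB w x y ↔ i < j))) := by
  have hne : ∀ i j (hi : i < k) (hj : j < k), i ≠ j → v ⟨i, hi⟩ ≠ v ⟨j, hj⟩ := by
    intro i j hi hj hij h
    exact hij (by simpa using hinj h)
  have hstep : ∀ n, n + 2 < k → w (τ n) (τ (n + 1)) := by
    intro n
    induction n with
    | zero => intro h; exact h0 h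
    | succ n ih =>
      intro h
      have e := ih (by omega)
      exact orient_step hw (hne n (n+2) (by omega) (by omega) (by omega))
        (hne (n+1) (n+2) (by omega) (by omega) (by omega))
        (hne (n+1) (n+3) (by omega) (by omega) (by omega))
        (hne (n+2) (n+3) (by omega) (by omega) (by omega))
        (hne n (n+1) (by omega) (by omega) (by omega))
        (hτ n (by omega)).1 (hτ n (by omega)).2
        (hτ (n+1) (by omega)).1 (hτ (n+1) (by omega)).2
        (hτ (n+2) (by omega)).1 (hτ (n+2) (by omega)).2 e
  have hmono : ∀ i d, i + d + 2 < k → w (τ i) (τ (i + d + 1)) := by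
    intro i d
    induction d with
    | zero => intro h; exact hstep i h
    | succ d ih =>
      intro h
      exact hw.trans _ _ _ (ih (by omega)) (hstep (i + d + 1) (by omega))
  have key : ∀ i j : Fin k, i < j → (∀ t, HasVal fA fB t (v i) → ¬ HasVal fA fB t (v j)) →
      ∃ s t, HasVal fA fB s (v i) ∧ HasVal fA fB t (v j) ∧ w s t := by
    rintro ⟨i, hi⟩ ⟨j, hj⟩ hij hdis
    have hij' : i < j := hij
    obtain ⟨d, rfl⟩ : ∃ d, j = i + d + 1 := ⟨j - i - 1, by omega⟩
    rcases d with _ | d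
    · exact absurd (hτ i hj).2 (hdis _ (hτ i hj).1)
    · exact ⟨τ i, τ (i + d + 1), (hτ i (by omega)).1, (hτ (i + d + 1) (by omega)).2,
        hmono i d (by omega)⟩
  constructor
  · intro i j x y hx hy
    have A : ∀ t z, HasVal fA fB t (Sum.inl z) ↔ fA t = z := by
      intro t z; simp [HasVal, eq_comm]
    constructor
    · rintro ⟨hxy, s, t, rfl, rfl, hst⟩
      by_contra hcon
      have hij : i ≠ j := by rintro rfl; rw [hx] at hy; exact hxy (by simpa using hy)
      have hji : j < i := by omega
      obtain ⟨p, q, hp, hq, hpq⟩ := key j i hji (by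
        intro t' h1 h2; rw [hy, A] at h1; rw [hx, A] at h2; exact hxy (by grind))
      rw [hy, A] at hp; rw [hx, A] at hq
      refine derived_asymm (x := Sum.inl (fA s)) (y := Sum.inl (fA t)) hw
        ?_ ?_ ?_ ?_ ((A _ _).2 rfl) ((A _ _).2 rfl) ((A _ _).2 hq) ((A _ _).2 hp) hst hpq <;>
        rw [A] <;> grind
    · intro hij
      have hxy : x ≠ y := by
        rintro rfl; exact hij.ne (hinj (hx.trans hy.symm))
      obtain ⟨p, q, hp, hq, hpq⟩ := key i j hij (by
        intro t' h1 h2; rw [hx, A] at h1; rw [hy, A] at h2; exact hxy (by grind))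
      rw [hx, A] at hp; rw [hy, A] at hq
      exact ⟨hxy, p, q, hp, hq, hpq⟩
  · intro i j x y hx hy
    have A : ∀ t z, HasVal fA fB t (Sum.inr z) ↔ fB t = z := by
      intro t z; simp [HasVal, eq_comm]
    constructor
    · rintro ⟨hxy, s, t, rfl, rfl, hst⟩
      by_contra hcon
      have hij : i ≠ j := by rintro rfl; rw [hx] at hy; exact hxy (by simpa using hy)
      have hji : j < i := by omega
      obtain ⟨p, q, hp, hq, hpq⟩ := key j i hji (by
        intro t' h1 h2; rw [hy, A] at h1; rw [hx, A] at h2; exact hxy (by grind))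
      rw [hy, A] at hp; rw [hx, A] at hq
      refine derived_asymm (x := Sum.inr (fB s)) (y := Sum.inr (fB t)) hw
        ?_ ?_ ?_ ?_ ((A _ _).2 rfl) ((A _ _).2 rfl) ((A _ _).2 hq) ((A _ _).2 hp) hst hpq <;>
        rw [A] <;> grind
    · intro hij
      have hxy : x ≠ y := by
        rintro rfl; exact hij.ne (hinj (hx.trans hy.symm))
      obtain ⟨p, q, hp, hq, hpq⟩ := key i j hij (by
        intro t' h1 h2; rw [hx, A] at h1; rw [hy, A] at h2; exact hxy (by grind))
      rw [hx, A] at hp; rw [hy, A] at hq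
      exact ⟨hxy, p, q, hp, hq, hpq⟩

/-- Suppose `BG'` is nonempty, connected, acyclic and without 3-fan-out, so
that it is a path `v 0 — v 1 — ... — v (k-1)` alternating between A-values and
B-values (formalized: `v` injectively enumerates the path, adjacency in `BG'`
holds exactly between consecutive path vertices, and every `BG'` edge lies on
the path).  Then every witness order of the candidate `A* ~ B*` derives, on
the A-values appearing on the path, either their order of appearance along the
path or its reverse, and simultaneously derives the correspondingly oriented
order on the B-values of the path; hence the derived orders restricted to the
path's vertices are unique up to simultaneous reversal (polarity). -/
theorem stmt8 {T α β : Type*} [Fintype T] [Nonempty T] (fA : T → α) (fB : T → β)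
    (k : ℕ) (hk : 2 ≤ k) (v : Fin k → α ⊕ β)
    (hinj : Function.Injective v)
    (hadj : ∀ i j : Fin k,
      (coGraph' fA fB).Adj (v i) (v j) ↔ (i.val + 1 = j.val ∨ j.val + 1 = i.val))
    (hsupp : ∀ x y : α ⊕ β, (coGraph' fA fB).Adj x y → ∃ i : Fin k, v i = x) :
    ∀ w : T → T → Prop, IsIIWitness fA fB w →
      ((∀ i j : Fin k, ∀ x y : α, v i = Sum.inl x → v j = Sum.inl y →
          (derivedA fA w x y ↔ i < j)) ∧
       (∀ i j : Fin k, ∀ x y : β, v i = Sum.inr x → v j = Sum.inr y →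
          (derivedB fB w x y ↔ i < j)))
      ∨
      ((∀ i j : Fin k, ∀ x y : α, v i = Sum.inl x → v j = Sum.inl y →
          (derivedA fA w x y ↔ j < i)) ∧
       (∀ i j : Fin k, ∀ x y : β, v i = Sum.inr x → v j = Sum.inr y →
          (derivedB fB w x y ↔ j < i))) := by
  intro w hw
  have hex : ∀ n, ∃ t : T, ∀ (h : n + 1 < k), HasVal fA fB t (v ⟨n, by omega⟩) ∧
      HasVal fA fB t (v ⟨n + 1, h⟩) := by
    intro n
    by_cases h : n + 1 < k
    · obtain ⟨t, h1, h2⟩ := hasVal_of_adj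
        ((hadj ⟨n, by omega⟩ ⟨n + 1, h⟩).2 (Or.inl rfl))
      exact ⟨t, fun _ => ⟨h1, h2⟩⟩
    · exact ⟨Classical.arbitrary T, fun h' => absurd h' h⟩
  choose τ hτ using hex
  by_cases h0 : 2 < k → w (τ 0) (τ 1)
  · exact Or.inl (oriented hτ hinj w hw h0)
  · right
    push Not at h0
    obtain ⟨hk2, hn⟩ := h0
    have hne : τ 0 ≠ τ 1 := by
      intro he
      have a := (hτ 0 (by omega)).1
      have b := (hτ 0 (by omega)).2
      have c := (hτ 1 (by omega)).2
      rw [← he] at c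
      rcases hasVal_pigeon a b c with h | h | h <;> simpa using hinj h
    have hw' : w (τ 1) (τ 0) := (hw.total _ _ hne).resolve_left hn
    obtain ⟨h1, h2⟩ := oriented hτ hinj _ (witness_swap hw) (fun _ => hw')
    constructor
    · intro i j x y hx hy
      rw [← h1 j i y x hy hx]
      constructor
      · rintro ⟨hxy, s, t, hs, ht, h⟩; exact ⟨hxy.symm, t, s, ht, hs, h⟩
      · rintro ⟨hxy, s, t, hs, ht, h⟩; exact ⟨hxy.symm, t, s, ht, hs, h⟩
    · intro i j x y hx hy
      rw [← h2 j i y x hy hx]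
      constructor
      · rintro ⟨hxy, s, t, hs, ht, h⟩; exact ⟨hxy.symm, t, s, ht, hs, h⟩
      · rintro ⟨hxy, s, t, hs, ht, h⟩; exact ⟨hxy.symm, t, s, ht, hs, h⟩
end

section
/- Let r be a table over attributes A and B such that the FD A→B holds in r. Then: (i) a witness order for the implicit-to-implicit candidate A* ~ B* always exists, so the candidate is valid; and (ii) for every pair of distinct B-values b, b' there exists a witness order deriving b ≺ b' and a witness order deriving b' ≺ b, and likewise for every pair of distinct A-values; consequently the intersection, over all witness orders, of the derived strict total orders on D_A (respectively on D_B) is the empty relation, i.e., the only derivable implicit partial orders A* and B* are the empty orders. -/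
/-- The functional dependency: any two tuples with equal values under `f`
have equal values under `g`. -/
def FDhold {T α β : Type*} (f : T → α) (g : T → β) : Prop :=
  ∀ s t : T, f s = f t → g s = g t

theorem exists_slo (T : Type*) : ∃ r : T → T → Prop,
    (∀ s t, s ≠ t → r s t ∨ r t s) ∧ (∀ s, ¬ r s s) ∧ (∀ s t u, r s t → r t u → r s u) := by
  refine ⟨WellOrderingRel, ?_, ?_, ?_⟩
  · intro s t h
    rcases trichotomous_of (WellOrderingRel (α := T)) s t with h1 | h1 | h1
    · exact Or.inl h1
    · exact absurd h1 h
    · exact Or.inr h1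
  · exact fun s => irrefl_of WellOrderingRel s
  · exact fun s t u => trans_of WellOrderingRel

theorem exists_witness {T α β : Type*} (fA : T → α) (fB : T → β) (hAB : FDhold fA fB) :
    ∃ w : T → T → Prop, IsIIWitness fA fB w := by
  obtain ⟨p, p1, p2, p3⟩ := exists_slo T
  obtain ⟨q, q1, q2, q3⟩ := exists_slo α
  obtain ⟨r, r1, r2, r3⟩ := exists_slo β
  unfold FDhold at hAB
  refine ⟨fun s t => r (fB s) (fB t) ∨
    (fB s = fB t ∧ (q (fA s) (fA t) ∨ (fA s = fA t ∧ p s t))), ?_, ?_, ?_, ?_, ?_⟩ <;> grind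

theorem IsIIWitness.rev {T α β : Type*} {fA : T → α} {fB : T → β} {w : T → T → Prop}
    (h : IsIIWitness fA fB w) : IsIIWitness fA fB (fun s t => w t s) := by
  obtain ⟨h1, h2, h3, h4, h5⟩ := h
  constructor <;> grind

/-- If the FD `A → B` holds, then (i) a witness order for the candidate
`A* ~ B*` always exists; (ii) for every pair of distinct occurring B-values
there is a witness deriving them in either direction, and likewise for
A-values; consequently the intersection over all witness orders of the derived
orders on A-values (resp. B-values) is the empty relation. -/
theorem stmt11 {T α β : Type*} [Fintype T] [Nonempty T]
    (fA : T → α) (fB : T → β) (hAB : FDhold fA fB) :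
    (∃ w : T → T → Prop, IsIIWitness fA fB w) ∧
    (∀ b b' : β, (∃ t : T, fB t = b) → (∃ t : T, fB t = b') → b ≠ b' →
      (∃ w : T → T → Prop, IsIIWitness fA fB w ∧ derivedB fB w b b') ∧
      (∃ w : T → T → Prop, IsIIWitness fA fB w ∧ derivedB fB w b' b)) ∧
    (∀ a a' : α, (∃ t : T, fA t = a) → (∃ t : T, fA t = a') → a ≠ a' →
      (∃ w : T → T → Prop, IsIIWitness fA fB w ∧ derivedA fA w a a') ∧
      (∃ w : T → T → Prop, IsIIWitness fA fB w ∧ derivedA fA w a' a)) ∧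
    (∀ a a' : α, ¬ ∀ w : T → T → Prop, IsIIWitness fA fB w → derivedA fA w a a') ∧
    (∀ b b' : β, ¬ ∀ w : T → T → Prop, IsIIWitness fA fB w → derivedB fB w b b') := by
  obtain ⟨w, hw⟩ := exists_witness fA fB hAB
  have hr := hw.rev
  refine ⟨⟨w, hw⟩, ?_, ?_, ?_, ?_⟩
  · rintro b b' ⟨s, rfl⟩ ⟨t, rfl⟩ hne
    rcases hw.total s t (fun h => hne (by rw [h])) with h | h
    · exact ⟨⟨w, hw, hne, s, t, rfl, rfl, h⟩, ⟨_, hr, hne.symm, t, s, rfl, rfl, h⟩⟩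
    · exact ⟨⟨_, hr, hne, s, t, rfl, rfl, h⟩, ⟨w, hw, hne.symm, t, s, rfl, rfl, h⟩⟩
  · rintro b b' ⟨s, rfl⟩ ⟨t, rfl⟩ hne
    rcases hw.total s t (fun h => hne (by rw [h])) with h | h
    · exact ⟨⟨w, hw, hne, s, t, rfl, rfl, h⟩, ⟨_, hr, hne.symm, t, s, rfl, rfl, h⟩⟩
    · exact ⟨⟨_, hr, hne, s, t, rfl, rfl, h⟩, ⟨w, hw, hne.symm, t, s, rfl, rfl, h⟩⟩
  · intro a a' H
    obtain ⟨hne, s, t, hs, ht, h⟩ := H w hw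
    obtain ⟨-, s', t', hs', ht', h'⟩ := H _ hr
    have e1 := hw.total s t'
    have e2 := hw.intervalA s t' s'
    have e3 := hw.intervalA t' s t
    grind
  · intro a a' H
    obtain ⟨hne, s, t, hs, ht, h⟩ := H w hw
    obtain ⟨-, s', t', hs', ht', h'⟩ := H _ hr
    have e1 := hw.total s t'
    have e2 := hw.intervalB s t' s'
    have e3 := hw.intervalB t' s t
    grind
end

section
/- Let r be a table over attributes A and B partitioned (by a context) into nonempty groups r_1, ..., r_p, and suppose that for each group r_i the graph BG' of r_i contains no 3-fan-out and no cycle. Then the following are equivalent: (1) there exist strict partial orders ≺_A on D_A and ≺_B on D_B such that for every group r_i and all tuples s, t ∈ r_i with s.A ≠ t.A and s.B ≠ t.B, either (s.A ≺_A t.A and s.B ≺_B t.B) or (t.A ≺_A s.A and t.B ≺_B s.B); (2) the unconditional implicit-to-implicit candidate A* ~ B* is valid, i.e., there exist strict partial orders P_A on D_A and P_B on D_B and, for each group r_i, a witness order of r_i whose derived strict total orders on the group's A-values and B-values are contained in P_A and P_B respectively. (Condition (1) states exactly the satisfiability of the SAT instance, with antisymmetry, no-swap, and transitivity clauses, constructed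 from r.) -/
/-- The co-occurrence bipartite graph `BG` of the set `S` of tuples. -/
def coGraphOn {T α β : Type*} (fA : T → α) (fB : T → β) (S : Set T) :
    SimpleGraph (α ⊕ β) :=
  SimpleGraph.fromRel (fun v u => ∃ t ∈ S, v = Sum.inl (fA t) ∧ u = Sum.inr (fB t))

/-- A singleton: a vertex of degree 1 in the `BG` of `S`. -/
def IsSingletonVtxOn {T α β : Type*} (fA : T → α) (fB : T → β) (S : Set T)
    (v : α ⊕ β) : Prop :=
  ∃! u : α ⊕ β, (coGraphOn fA fB S).Adj v u

/-- `BG'` of `S`: obtained from `BG` by deleting all singletons together with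
their incident edges. -/
def coGraphOn' {T α β : Type*} (fA : T → α) (fB : T → β) (S : Set T) :
    SimpleGraph (α ⊕ β) :=
  SimpleGraph.fromRel (fun v u =>
    (coGraphOn fA fB S).Adj v u ∧
      ¬ IsSingletonVtxOn fA fB S v ∧ ¬ IsSingletonVtxOn fA fB S u)

/-- No vertex adjacent to at least three distinct vertices. -/
def NoThreeFanOut {V : Type*} (G : SimpleGraph V) : Prop :=
  ¬ ∃ v u₁ u₂ u₃ : V, u₁ ≠ u₂ ∧ u₁ ≠ u₃ ∧ u₂ ≠ u₃ ∧
      G.Adj v u₁ ∧ G.Adj v u₂ ∧ G.Adj v u₃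

/-- A witness order for the implicit-to-implicit candidate `A* ~ B*` over the
set `S` of tuples. -/
structure IsIIWitnessOn {T α β : Type*} (fA : T → α) (fB : T → β)
    (S : Set T) (w : T → T → Prop) : Prop where
  total : ∀ s ∈ S, ∀ t ∈ S, s ≠ t → w s t ∨ w t s
  irrefl : ∀ s ∈ S, ¬ w s s
  trans : ∀ s ∈ S, ∀ t ∈ S, ∀ u ∈ S, w s t → w t u → w s u
  intervalA : ∀ s ∈ S, ∀ t ∈ S, ∀ u ∈ S, w s t → w t u → fA s = fA u → fA s = fA t
  intervalB : ∀ s ∈ S, ∀ t ∈ S, ∀ u ∈ S, w s t → w t u → fB s = fB u → fB s = fB t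

/-- The derived order on the A-values occurring in `S`. -/
def derivedAOn {T α : Type*} (fA : T → α) (S : Set T) (w : T → T → Prop)
    (x y : α) : Prop :=
  x ≠ y ∧ ∃ s ∈ S, ∃ t ∈ S, fA s = x ∧ fA t = y ∧ w s t

/-- The derived order on the B-values occurring in `S`. -/
def derivedBOn {T β : Type*} (fB : T → β) (S : Set T) (w : T → T → Prop)
    (x y : β) : Prop :=
  x ≠ y ∧ ∃ s ∈ S, ∃ t ∈ S, fB s = x ∧ fB t = y ∧ w s t

/-- A strict partial order: an irreflexive and transitive relation. -/
def IsSPO {γ : Type*} (P : γ → γ → Prop) : Prop :=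
  (∀ x : γ, ¬ P x x) ∧ ∀ x y z : γ, P x y → P y z → P x z

theorem spo_extend {γ : Type*} (P : γ → γ → Prop) (h : IsSPO P) :
    ∃ L : LinearOrder γ, ∀ x y, P x y → L.lt x y := by
  classical
  obtain ⟨hi, ht⟩ := h
  let r : γ → γ → Prop := fun x y => x = y ∨ P x y
  haveI : IsPartialOrder γ r :=
    { refl := fun x => Or.inl rfl
      trans := by
        rintro x y z (rfl | h1) (rfl | h2)
        · exact Or.inl rfl
        · exact Or.inr h2
        · exact Or.inr h1
        · exact Or.inr (ht _ _ _ h1 h2)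
      antisymm := by
        rintro x y (h1 | h1) (h2 | h2)
        · exact h1
        · exact h1
        · exact h2.symm
        · exact absurd (ht _ _ _ h1 h2) (hi _) }
  obtain ⟨s, hs, hrs⟩ := extend_partialOrder r
  let L : LinearOrder γ :=
    { le := s
      le_refl := hs.refl
      le_trans := hs.trans
      le_antisymm := hs.antisymm
      le_total := hs.total
      toDecidableLE := Classical.decRel _ }
  refine ⟨L, fun x y hxy => ?_⟩
  have h1 : L.le x y := hrs x y (Or.inr hxy)
  have h2 : x ≠ y := by
    rintro rfl
    exact hi _ hxy
  exact lt_of_le_of_ne h1 h2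

/-- Let the table be partitioned by a context into nonempty groups (fibers of
`c`) whose graphs `BG'` contain no 3-fan-out and no cycle.  Then the following
are equivalent: (1) there are strict partial orders `≺_A`, `≺_B` such that for
every group and all tuples `s, t` of the group with `s.A ≠ t.A` and
`s.B ≠ t.B`, either `s.A ≺_A t.A ∧ s.B ≺_B t.B` or `t.A ≺_A s.A ∧
t.B ≺_B s.B` (the satisfiability of the SAT instance constructed from `r`);
(2) the unconditional candidate `A* ~ B*` is valid: there are strict partial
orders `P_A`, `P_B` and, per group, a witness order whose derived orders are
contained in `P_A` and `P_B` respectively. -/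
theorem stmt12 {T α β ι : Type*} [Fintype T] (fA : T → α) (fB : T → β)
    (c : T → ι) (hne : ∀ i : ι, ∃ t : T, c t = i)
    (hfan : ∀ i : ι, NoThreeFanOut (coGraphOn' fA fB {t | c t = i}))
    (hacyc : ∀ i : ι, (coGraphOn' fA fB {t | c t = i}).IsAcyclic) :
    (∃ (PA : α → α → Prop) (PB : β → β → Prop), IsSPO PA ∧ IsSPO PB ∧
        ∀ s t : T, c s = c t → fA s ≠ fA t → fB s ≠ fB t →
          ((PA (fA s) (fA t) ∧ PB (fB s) (fB t)) ∨
           (PA (fA t) (fA s) ∧ PB (fB t) (fB s))))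
    ↔
    (∃ (PA : α → α → Prop) (PB : β → β → Prop), IsSPO PA ∧ IsSPO PB ∧
        ∃ w : ι → T → T → Prop, ∀ i : ι,
          IsIIWitnessOn fA fB {t | c t = i} (w i) ∧
          (∀ x y : α, derivedAOn fA {t | c t = i} (w i) x y → PA x y) ∧
          (∀ x y : β, derivedBOn fB {t | c t = i} (w i) x y → PB x y)) := by
  constructor
  · rintro ⟨PA, PB, hA, hB, h⟩
    obtain ⟨LA, hLA⟩ := spo_extend PA hA
    obtain ⟨LB, hLB⟩ := spo_extend PB hB
    let e := Fintype.equivFin T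
    let w : T → T → Prop := fun s t => fA s < fA t ∨ (fA s = fA t ∧
      (fB s < fB t ∨ (fB s = fB t ∧ e s < e t)))
    have mA : ∀ s t, w s t → fA s ≤ fA t := by
      rintro s t (h1 | ⟨h1, -⟩)
      · exact h1.le
      · exact h1.le
    have mB : ∀ s t, c s = c t → w s t → fB s ≤ fB t := by
      rintro s t hc (h1 | ⟨h1, h2 | ⟨h2, -⟩⟩)
      · by_cases hb : fB s = fB t
        · exact hb.le
        · rcases h s t hc h1.ne hb with ⟨_, h3⟩ | ⟨h3, _⟩
          · exact (hLB _ _ h3).le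
          · exact absurd (hLA _ _ h3) (lt_asymm h1)
      · exact h2.le
      · exact h2.le
    refine ⟨fun x y => x < y, fun x y => x < y, ⟨fun x => lt_irrefl x, fun x y z => lt_trans⟩,
      ⟨fun x => lt_irrefl x, fun x y z => lt_trans⟩, fun _ => w, fun i => ⟨⟨?_, ?_, ?_, ?_, ?_⟩, ?_, ?_⟩⟩
    · intro s _ t _ hst
      rcases lt_trichotomy (fA s) (fA t) with h1 | h1 | h1
      · exact Or.inl (Or.inl h1)
      · rcases lt_trichotomy (fB s) (fB t) with h2 | h2 | h2
        · exact Or.inl (Or.inr ⟨h1, Or.inl h2⟩)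
        · rcases lt_or_gt_of_ne (e.injective.ne hst) with h3 | h3
          · exact Or.inl (Or.inr ⟨h1, Or.inr ⟨h2, h3⟩⟩)
          · exact Or.inr (Or.inr ⟨h1.symm, Or.inr ⟨h2.symm, h3⟩⟩)
        · exact Or.inr (Or.inr ⟨h1.symm, Or.inl h2⟩)
      · exact Or.inr (Or.inl h1)
    · intro s _ hs
      simp [w] at hs
    · rintro s _ t _ u _ (h1 | ⟨h1, h2⟩) (h3 | ⟨h3, h4⟩)
      · exact Or.inl (h1.trans h3)
      · exact Or.inl (h3 ▸ h1)
      · exact Or.inl (h1 ▸ h3)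
      · refine Or.inr ⟨h1.trans h3, ?_⟩
        rcases h2 with h2 | ⟨h2, h5⟩ <;> rcases h4 with h4 | ⟨h4, h6⟩
        · exact Or.inl (h2.trans h4)
        · exact Or.inl (h4 ▸ h2)
        · exact Or.inl (h2 ▸ h4)
        · exact Or.inr ⟨h2.trans h4, h5.trans h6⟩
    · intro s _ t _ u _ h1 h2 h3
      exact le_antisymm (mA _ _ h1) (h3 ▸ mA _ _ h2)
    · intro s hs t ht u hu h1 h2 h3
      exact le_antisymm (mB _ _ (hs.trans ht.symm) h1) (h3 ▸ mB _ _ (ht.trans hu.symm) h2)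
    · rintro x y ⟨hxy, s, hs, t, ht, rfl, rfl, hw⟩
      exact lt_of_le_of_ne (mA _ _ hw) hxy
    · rintro x y ⟨hxy, s, hs, t, ht, rfl, rfl, hw⟩
      exact lt_of_le_of_ne (mB _ _ (hs.trans ht.symm) hw) hxy
  · rintro ⟨PA, PB, hA, hB, w, h⟩
    refine ⟨PA, PB, hA, hB, fun s t hc ha hb => ?_⟩
    obtain ⟨hw, h1, h2⟩ := h (c t)
    have hst : s ≠ t := by
      rintro rfl
      exact ha rfl
    rcases hw.total s hc t rfl hst with h3 | h3
    · exact Or.inl ⟨h1 _ _ ⟨ha, s, hc, t, rfl, rfl, rfl, h3⟩,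
        h2 _ _ ⟨hb, s, hc, t, rfl, rfl, rfl, h3⟩⟩
    · exact Or.inr ⟨h1 _ _ ⟨ha.symm, t, rfl, s, hc, rfl, rfl, h3⟩,
        h2 _ _ ⟨hb.symm, t, rfl, s, hc, rfl, rfl, h3⟩⟩
end
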